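/- Let M be an entire function of exponential type, positive on the real line, with ∫_R log⁺ M(x)/(1+x²) dx < ∞, and suppose M is even. Then there exists an entire function U of exponential type half that of M, with all zeros in the open lower half-plane, such that U(z)U*(z) = M(z) for all z and U*(z) = U(-z) for all z. -/

import Mathlib

open Complex MeasureTheory

noncomputable def estar (E : ℂ → ℂ) (z : ℂ) : ℂ := (starRingEnd ℂ) (E ((starRingEnd ℂ) z))

def ExpType (F : ℂ → ℂ) (τ : ℝ) : Prop :=
  ∀ ε > (0 : ℝ), ∃ C : ℝ, ∀ z : ℂ, ‖F z‖ ≤ C * Real.exp ((τ + ε) * ‖z‖)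

open Set Filter Topology Metric

theorem differentiableAt_integral_of_norm_le {α : Type*} [MeasurableSpace α] {μ : Measure α}
    {f : ℂ → α → ℂ} {z₀ : ℂ} {ρ : ℝ} (hρ : 0 < ρ) {g : α → ℝ}
    (hmeas : ∀ z ∈ ball z₀ ρ, AEStronglyMeasurable (f z) μ)
    (hd : ∀ᵐ t ∂μ, DifferentiableOn ℂ (fun z => f z t) (ball z₀ ρ))
    (hb : ∀ᵐ t ∂μ, ∀ z ∈ ball z₀ ρ, ‖f z t‖ ≤ g t) (hg : Integrable g μ) :
    DifferentiableAt ℂ (fun z => ∫ t, f z t ∂μ) z₀ := by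
  have hz₀ : z₀ ∈ ball z₀ ρ := mem_ball_self hρ
  have key := hasDerivAt_integral_of_dominated_loc_of_deriv_le (μ := μ) (F := f)
    (F' := fun z t => deriv (fun z => f z t) z) (x₀ := z₀) (s := ball z₀ (ρ / 2))
    (bound := fun t => g t / (ρ / 4)) (ball_mem_nhds z₀ (by positivity))
    (by filter_upwards [ball_mem_nhds z₀ hρ] with z hz using hmeas z hz)
    (hg.mono' (hmeas z₀ hz₀) (by filter_upwards [hb] with t ht using ht z₀ hz₀)) ?_ ?_
    (hg.div_const _) ?_
  · exact key.2.differentiableAt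
  · obtain ⟨w, hw0, hw, hwt⟩ : ∃ w : ℕ → ℂ, (∀ n, w n ≠ z₀) ∧ (∀ n, w n ∈ ball z₀ ρ) ∧
        Tendsto w atTop (𝓝 z₀) := by
      have hne : (𝓝[≠] z₀).NeBot := inferInstance
      obtain ⟨w, hw⟩ := exists_seq_tendsto (𝓝[≠] z₀)
      have h1 : ∀ᶠ n in atTop, w n ∈ ball z₀ ρ ∧ w n ≠ z₀ := by
        refine hw.eventually (Filter.Eventually.and ?_ self_mem_nhdsWithin)
        exact mem_nhdsWithin_of_mem_nhds (ball_mem_nhds z₀ hρ)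
      obtain ⟨N, hN⟩ := eventually_atTop.1 h1
      refine ⟨fun n => w (n + N), fun n => (hN _ (by omega)).2, fun n => (hN _ (by omega)).1, ?_⟩
      exact (tendsto_add_atTop_iff_nat N).2 (hw.mono_right nhdsWithin_le_nhds)
    refine aestronglyMeasurable_of_tendsto_ae atTop
      (f := fun n t => (w n - z₀)⁻¹ * (f (w n) t - f z₀ t)) (fun n => ?_) ?_
    · exact ((hmeas _ (hw n)).sub (hmeas _ hz₀)).const_mul _
    · filter_upwards [hd] with t ht
      have h2 := (ht.differentiableAt (ball_mem_nhds z₀ hρ)).hasDerivAt.tendsto_slope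
      have h3 : Tendsto w atTop (𝓝[≠] z₀) :=
        tendsto_nhdsWithin_iff.2 ⟨hwt, Eventually.of_forall hw0⟩
      exact h2.comp h3
  · filter_upwards [hd, hb] with t ht hbt z hz
    have hsub : closedBall z (ρ / 4) ⊆ ball z₀ ρ := by
      intro y hy
      have := dist_triangle y z z₀
      simp only [mem_ball, mem_closedBall] at *
      linarith
    refine norm_deriv_le_of_forall_mem_sphere_norm_le (by positivity)
      ((ht.mono hsub).diffContOnCl_ball subset_rfl) fun y hy => hbt y (hsub ?_)
    exact sphere_subset_closedBall hy
  · filter_upwards [hd] with t ht z hz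
    have hz' : z ∈ ball z₀ ρ := ball_subset_ball (by linarith) hz
    exact (ht.differentiableAt (isOpen_ball.mem_nhds hz')).hasDerivAt

/-- The kernel representing holomorphic functions in the half-plane by the boundary values of
their real part. -/
noncomputable def nevKernel (z : ℂ) (t : ℝ) : ℂ := (1 + t * z) / (t - z)

theorem nevKernel_eq {z : ℂ} {t : ℝ} (h : (t : ℂ) - z ≠ 0) :
    nevKernel z t = z + (1 + z ^ 2) / (t - z) := by
  unfold nevKernel
  field_simp
  ring

theorem measurable_nevKernel (z : ℂ) : Measurable (nevKernel z) := by
  unfold nevKernel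
  fun_prop

theorem norm_nevKernel_le {z : ℂ} {t : ℝ} {δ : ℝ} (hδ : 0 < δ) (h : δ ≤ ‖(t : ℂ) - z‖) :
    ‖nevKernel z t‖ ≤ ‖z‖ + (1 + ‖z‖ ^ 2) / δ := by
  have h0 : (t : ℂ) - z ≠ 0 := norm_pos_iff.1 (hδ.trans_le h)
  rw [nevKernel_eq h0]
  refine (norm_add_le _ _).trans ?_
  gcongr
  rw [norm_div]
  gcongr
  refine (norm_add_le _ _).trans ?_
  simp

theorem differentiableAt_integral_nevKernel {μ : Measure ℝ} {v : ℝ → ℝ} (hv : Integrable v μ)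
    {z₀ : ℂ} {ρ : ℝ} (hρ : 0 < ρ) (h : ∀ᵐ t : ℝ ∂μ, ρ ≤ ‖(t : ℂ) - z₀‖) :
    DifferentiableAt ℂ (fun z => ∫ t, (v t : ℂ) * nevKernel z t ∂μ) z₀ := by
  have hlow : ∀ t : ℝ, ρ ≤ ‖(t : ℂ) - z₀‖ → ∀ z ∈ ball z₀ (ρ / 2), ρ / 2 ≤ ‖(t : ℂ) - z‖ := by
    intro t ht z hz
    rw [mem_ball, dist_eq_norm] at hz
    have := norm_sub_le_norm_sub_add_norm_sub (t : ℂ) z z₀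
    linarith
  refine differentiableAt_integral_of_norm_le (ρ := ρ / 2) (by positivity)
    (g := fun t => ‖v t‖ * (‖z₀‖ + ρ / 2 + (1 + (‖z₀‖ + ρ / 2) ^ 2) / (ρ / 2))) ?_ ?_ ?_
    (hv.norm.mul_const _)
  · intro z _
    exact (Complex.continuous_ofReal.comp_aestronglyMeasurable hv.1).mul
      (measurable_nevKernel z).aestronglyMeasurable
  · filter_upwards [h] with t ht z hz
    have h1 := hlow t ht z hz
    have h0 : (t : ℂ) - z ≠ 0 := norm_pos_iff.1 (by linarith)
    have : DifferentiableAt ℂ (fun z => (v t : ℂ) * nevKernel z t) z := by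
      unfold nevKernel
      fun_prop (disch := assumption)
    exact this.differentiableWithinAt
  · filter_upwards [h] with t ht z hz
    rw [norm_mul, Complex.norm_real]
    have hzn : ‖z‖ ≤ ‖z₀‖ + ρ / 2 := by
      rw [mem_ball, dist_eq_norm] at hz
      have := norm_sub_norm_le z z₀
      linarith
    refine mul_le_mul_of_nonneg_left
      ((norm_nevKernel_le (by positivity) (hlow t ht z hz)).trans ?_) (norm_nonneg _)
    gcongr

theorem abs_im_le_norm_ofReal_sub (t : ℝ) (z : ℂ) : |z.im| ≤ ‖(t : ℂ) - z‖ := by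
  have := Complex.abs_im_le_norm ((t : ℂ) - z)
  simpa using this

theorem ofReal_sub_ne_zero {z : ℂ} (hz : z.im ≠ 0) (t : ℝ) : (t : ℂ) - z ≠ 0 :=
  norm_pos_iff.1 ((abs_pos.2 hz).trans_le (abs_im_le_norm_ofReal_sub t z))

/-- The integral `(2πi)⁻¹ ∫ u(t) (1 + tz) / ((t - z) (1 + t²)) dt`; its real part in the upper
half-plane is half of the Poisson integral of `u`. -/
noncomputable def outerLog (u : ℝ → ℝ) (z : ℂ) : ℂ :=
  (2 * Real.pi * I)⁻¹ * ∫ t : ℝ, ((u t / (1 + t ^ 2) : ℝ) : ℂ) * nevKernel z t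

theorem integrable_mul_nevKernel {v : ℝ → ℝ} (hv : Integrable v) {z : ℂ} (hz : z.im ≠ 0) :
    Integrable fun t : ℝ => (v t : ℂ) * nevKernel z t :=
  hv.ofReal.mul_bdd (measurable_nevKernel z).aestronglyMeasurable
    (Eventually.of_forall fun t =>
      norm_nevKernel_le (abs_pos.2 hz) (abs_im_le_norm_ofReal_sub t z))

theorem differentiableAt_outerLog {u : ℝ → ℝ} (hu : Integrable fun t => u t / (1 + t ^ 2))
    {z : ℂ} (hz : z.im ≠ 0) : DifferentiableAt ℂ (outerLog u) z :=
  (differentiableAt_integral_nevKernel hu (abs_pos.2 hz)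
    (Eventually.of_forall fun t : ℝ => abs_im_le_norm_ofReal_sub t z)).const_mul _

theorem outerLog_neg {u : ℝ → ℝ} (hu : ∀ t, u (-t) = u t) (z : ℂ) :
    outerLog u (-z) = -outerLog u z := by
  unfold outerLog
  rw [← mul_neg, ← integral_neg, ← integral_neg_eq_self]
  congr 2
  ext t
  simp only [hu, nevKernel]
  rw [← mul_neg, ← div_neg]
  push_cast
  congr 2 <;> ring

theorem conj_outerLog_conj (u : ℝ → ℝ) (z : ℂ) :
    (starRingEnd ℂ) (outerLog u ((starRingEnd ℂ) z)) = -outerLog u z := by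
  unfold outerLog nevKernel
  rw [map_mul, ← integral_conj]
  simp only [map_mul, map_div₀, map_sub, map_add, map_inv₀, Complex.conj_ofReal, Complex.conj_conj,
    Complex.conj_I, map_one, map_ofNat]
  rw [mul_neg, inv_neg, neg_mul]

theorem re_mul_nevKernel {z : ℂ} (hz : z.im ≠ 0) (t : ℝ) :
    (I⁻¹ * nevKernel z t).re = (1 + t ^ 2) * (z.im / ((t - z.re) ^ 2 + z.im ^ 2)) := by
  have h0 := ofReal_sub_ne_zero hz t
  have h1 : (t - z.re) ^ 2 + z.im ^ 2 ≠ 0 := by positivity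
  have h2 : normSq ((t : ℂ) - z) = (t - z.re) ^ 2 + z.im ^ 2 := by
    simp [normSq_apply]; ring
  unfold nevKernel
  rw [Complex.inv_I, neg_mul, Complex.neg_re, Complex.I_mul_re, Complex.div_im, h2]
  simp
  field_simp
  ring

theorem outerLog_re {u : ℝ → ℝ} (hu : Integrable fun t => u t / (1 + t ^ 2))
    {z : ℂ} (hz : z.im ≠ 0) :
    Integrable (fun t => u t * (z.im / ((t - z.re) ^ 2 + z.im ^ 2))) ∧
    (outerLog u z).re =
      (2 * Real.pi)⁻¹ * ∫ t, u t * (z.im / ((t - z.re) ^ 2 + z.im ^ 2)) := by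
  have hint := (integrable_mul_nevKernel hu hz).const_mul I⁻¹
  have hpt : ∀ t : ℝ, (I⁻¹ * (((u t / (1 + t ^ 2) : ℝ) : ℂ) * nevKernel z t)).re =
      u t * (z.im / ((t - z.re) ^ 2 + z.im ^ 2)) := by
    intro t
    rw [mul_left_comm, Complex.re_ofReal_mul, re_mul_nevKernel hz]
    field_simp
  constructor
  · simpa only [RCLike.re_to_complex, hpt] using hint.re
  · have : outerLog u z = ((2 * Real.pi)⁻¹ : ℝ) *
        ∫ t : ℝ, I⁻¹ * (((u t / (1 + t ^ 2) : ℝ) : ℂ) * nevKernel z t) := by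
      rw [integral_const_mul, outerLog]
      push_cast
      rw [mul_inv _ I]
      ring
    rw [this, Complex.re_ofReal_mul]
    congr 1
    rw [← RCLike.re_to_complex, ← integral_re hint]
    simp only [RCLike.re_to_complex, hpt]

theorem integral_inv_ofReal_sub {a b : ℝ} {z : ℂ} (hz : z.im ≠ 0) :
    ∫ t in a..b, ((t : ℂ) - z)⁻¹ = Complex.log (b - z) - Complex.log (a - z) := by
  have hne := ofReal_sub_ne_zero hz
  refine intervalIntegral.integral_eq_sub_of_hasDerivAt
    (f := fun t : ℝ => Complex.log ((t : ℂ) - z)) (fun t _ => ?_) ?_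
  · have h1 : HasDerivAt (fun t : ℝ => (t : ℂ) - z) 1 t :=
      (HasDerivAt.ofReal_comp (hasDerivAt_id t)).sub_const z
    have h2 : (t : ℂ) - z ∈ slitPlane := by
      rw [mem_slitPlane_iff]; right; simpa using hz
    simpa using h1.clog_real h2
  · refine ContinuousOn.intervalIntegrable ?_
    exact (Continuous.inv₀ (by fun_prop) hne).continuousOn

theorem log_neg_of_im_pos {w : ℂ} (hw : 0 < w.im) :
    Complex.log (-w) = Complex.log w - Real.pi * I := by
  simp [Complex.log, arg_neg_eq_arg_sub_pi_of_im_pos hw]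
  ring

theorem log_neg_of_im_neg {w : ℂ} (hw : w.im < 0) :
    Complex.log (-w) = Complex.log w + Real.pi * I := by
  simp [Complex.log, arg_neg_eq_arg_add_pi_of_im_neg hw]
  ring

theorem dslope_comm {𝕜 E : Type*} [NontriviallyNormedField 𝕜] [NormedAddCommGroup E]
    [NormedSpace 𝕜 E] (f : 𝕜 → E) (a b : 𝕜) : dslope f a b = dslope f b a := by
  rcases eq_or_ne a b with rfl | h
  · rfl
  · rw [dslope_of_ne _ h.symm, dslope_of_ne _ h, slope_comm]

theorem differentiableAt_integral_dslope {H : ℂ → ℂ} {c : ℂ} {R r : ℝ} (hrR : r < R)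
    (hH : DifferentiableOn ℂ H (ball c R)) {μ : Measure ℝ} [IsFiniteMeasure μ] {s : Set ℝ}
    (hs : MeasurableSet s) (hsr : ∀ t ∈ s, (t : ℂ) ∈ closedBall c r) {z : ℂ} (hz : z ∈ ball c r) :
    DifferentiableAt ℂ (fun z => ∫ t in s, dslope H (t : ℂ) z ∂μ) z := by
  have hsub : closedBall c r ⊆ ball c R := closedBall_subset_ball hrR
  obtain ⟨K, hK⟩ := (isCompact_closedBall c r).exists_bound_of_continuousOn
    ((hH.deriv isOpen_ball).continuousOn.mono hsub)
  obtain ⟨ρ, hρ, hρr⟩ := isOpen_iff.1 isOpen_ball z hz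
  have hbound : ∀ t ∈ closedBall c r, ∀ w ∈ closedBall c r, ‖dslope H t w‖ ≤ K := by
    intro t ht w hw
    rcases eq_or_ne w t with rfl | hne
    · rw [dslope_same]; exact hK _ ht
    · rw [dslope_of_ne _ hne, slope_def_field, norm_div,
        div_le_iff₀ (norm_pos_iff.2 (sub_ne_zero.2 hne))]
      exact (convex_closedBall c r).norm_image_sub_le_of_norm_deriv_le
        (fun x hx => hH.differentiableAt (isOpen_ball.mem_nhds (hsub hx))) hK ht hw
  refine differentiableAt_integral_of_norm_le hρ (g := fun _ => K) ?_ ?_ ?_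
    (integrable_const K)
  · intro w hw
    simp only [fun t : ℝ => dslope_comm H (t : ℂ) w]
    have hw' : w ∈ ball c R := hsub (ball_subset_closedBall (hρr hw))
    have h1 : ContinuousOn (dslope H w) (ball c R) :=
      ((differentiableOn_dslope (isOpen_ball.mem_nhds hw')).2 hH).continuousOn
    exact (h1.comp Complex.continuous_ofReal.continuousOn
      fun t ht => hsub (hsr t ht)).aestronglyMeasurable hs
  · filter_upwards [ae_restrict_mem hs] with t ht
    exact ((differentiableOn_dslope (isOpen_ball.mem_nhds (hsub (hsr t ht)))).2 hH).mono
      (hρr.trans (ball_subset_closedBall.trans hsub))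
  · filter_upwards [ae_restrict_mem hs] with t ht w hw
    exact hbound _ (hsr t ht) _ (ball_subset_closedBall (hρr hw))

theorem exists_local_extension {M : ℂ → ℂ} (hM : Differentiable ℂ M)
    (hpos : ∀ x : ℝ, 0 < (M x).re ∧ (M x).im = 0)
    (hu : Integrable fun t : ℝ => Real.log (M t).re / (1 + t ^ 2)) (x : ℝ) :
    ∃ r > 0, ∃ E : ℂ → ℂ, DifferentiableOn ℂ E (ball (x : ℂ) r) ∧ ∀ z ∈ ball (x : ℂ) r,
      (0 < z.im → E z = exp (outerLog (fun t => Real.log (M t).re) z)) ∧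
      (z.im < 0 → E z = M z * exp (outerLog (fun t => Real.log (M t).re) z)) := by
  set u : ℝ → ℝ := fun t => Real.log (M t).re with hu_def
  obtain ⟨R, hR, hball⟩ : ∃ R > 0, ball (x : ℂ) R ⊆ M ⁻¹' slitPlane := by
    refine Metric.mem_nhds_iff.1 (hM.continuous.continuousAt.preimage_mem_nhds
      (isOpen_slitPlane.mem_nhds ?_))
    exact mem_slitPlane_iff.2 (Or.inl (hpos x).1)
  set H : ℂ → ℂ := fun z => Complex.log (M z) with hH_def
  have hH : DifferentiableOn ℂ H (ball (x : ℂ) R) := fun z hz =>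
    ((hM z).clog (hball hz)).differentiableWithinAt
  have hexpH : ∀ z ∈ ball (x : ℂ) R, exp (H z) = M z := fun z hz =>
    Complex.exp_log (slitPlane_ne_zero (hball hz))
  have hHu : ∀ t : ℝ, H t = (u t : ℂ) := by
    intro t
    rw [hH_def, hu_def]
    rw [Complex.ofReal_log (hpos t).1.le]
    exact congrArg Complex.log (Complex.ext (by simp) (by simp [(hpos t).2]))
  set r := R / 2 with hr_def
  have hr : 0 < r := by positivity
  have hrR : r < R := by linarith
  set s : Set ℝ := Ioc (x - r) (x + r) with hs_def
  have hs : MeasurableSet s := measurableSet_Ioc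
  have hsr : ∀ t ∈ s, (t : ℂ) ∈ closedBall (x : ℂ) r := by
    intro t ht
    rw [mem_closedBall, dist_eq_norm, ← Complex.ofReal_sub, Complex.norm_real, Real.norm_eq_abs,
      abs_le]
    constructor <;> linarith [ht.1, ht.2]
  have hsc : ∀ t ∈ sᶜ, r ≤ ‖(t : ℂ) - x‖ := by
    intro t ht
    rw [← Complex.ofReal_sub, Complex.norm_real, Real.norm_eq_abs]
    by_contra! hlt
    rw [abs_lt] at hlt
    exact ht ⟨by linarith, by linarith⟩
  set far : ℂ → ℂ := fun z => ∫ t in sᶜ, ((u t / (1 + t ^ 2) : ℝ) : ℂ) * nevKernel z t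
  set D : ℂ → ℂ := fun z => ∫ t in s, dslope H (t : ℂ) z
  set c : ℂ := ∫ t in s, ((u t / (1 + t ^ 2) * t : ℝ) : ℂ)
  have hcu : Continuous u := by
    have : Continuous fun t : ℝ => (M t).re :=
      Complex.continuous_re.comp (hM.continuous.comp Complex.continuous_ofReal)
    exact this.log fun t => (hpos t).1.ne'
  have hfin : IsFiniteMeasure (volume.restrict s) := by
    rw [hs_def]; infer_instance
  refine ⟨r, hr, fun z => exp ((2 * Real.pi * I)⁻¹ * (far z + D z - c + H z *
    (Complex.log ((x + r : ℝ) - z) - Complex.log (z - (x - r : ℝ)))) + H z / 2), ?_, ?_⟩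
  · intro z hz
    have hzR : z ∈ ball (x : ℂ) R := ball_subset_ball hrR.le hz
    have hre : |z.re - x| < r := by
      have h1 := Complex.abs_re_le_norm (z - x)
      rw [mem_ball, dist_eq_norm] at hz
      simpa using h1.trans_lt hz
    rw [abs_lt] at hre
    have h1 : ((x + r : ℝ) : ℂ) - z ∈ slitPlane := by
      rw [mem_slitPlane_iff]; left
      simp only [Complex.sub_re, Complex.ofReal_re]; linarith
    have h2 : z - ((x - r : ℝ) : ℂ) ∈ slitPlane := by
      rw [mem_slitPlane_iff]; left
      simp only [Complex.sub_re, Complex.ofReal_re]; linarith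
    have h3 : DifferentiableAt ℂ far z := by
      rw [mem_ball, dist_eq_norm] at hz
      refine differentiableAt_integral_nevKernel hu.integrableOn (ρ := r - ‖z - x‖)
        (by linarith) ?_
      filter_upwards [ae_restrict_mem hs.compl] with t ht
      have := norm_sub_le_norm_sub_add_norm_sub (t : ℂ) z x
      have := hsc t ht
      linarith
    have h4 : DifferentiableAt ℂ D z := by
      have := differentiableAt_integral_dslope (μ := volume.restrict s) hrR hH hs hsr hz
      simpa only [Measure.restrict_restrict hs, Set.inter_self] using this
    have h5 : DifferentiableAt ℂ H z := hH.differentiableAt (isOpen_ball.mem_nhds hzR)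
    have h6 : DifferentiableAt ℂ (fun z => Complex.log ((x + r : ℝ) - z)) z :=
      DifferentiableAt.clog (by fun_prop) h1
    have h7 : DifferentiableAt ℂ (fun z => Complex.log (z - (x - r : ℝ))) z :=
      DifferentiableAt.clog (by fun_prop) h2
    refine DifferentiableAt.differentiableWithinAt ?_
    fun_prop
  · intro z hz
    have hzR : z ∈ ball (x : ℂ) R := ball_subset_ball hrR.le hz
    have key : z.im ≠ 0 → outerLog u z = (2 * Real.pi * I)⁻¹ * (far z + D z - c + H z *
        (Complex.log ((x + r : ℝ) - z) - Complex.log ((x - r : ℝ) - z))) := by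
      intro him
      have hne := ofReal_sub_ne_zero him
      have hi1 : IntegrableOn (fun t : ℝ => H z * ((t : ℂ) - z)⁻¹) s :=
        (Continuous.integrableOn_Icc (by
          exact continuous_const.mul (Continuous.inv₀ (by fun_prop) hne))).mono_set
          Ioc_subset_Icc_self
      have hi2 : IntegrableOn (fun t : ℝ => ((u t / (1 + t ^ 2) * t : ℝ) : ℂ)) s := by
        refine (Continuous.integrableOn_Icc (Complex.continuous_ofReal.comp ?_)).mono_set
          Ioc_subset_Icc_self
        exact (hcu.div (by fun_prop) fun t => by positivity).mul continuous_id
      have hi3 : IntegrableOn (fun t : ℝ => ((u t / (1 + t ^ 2) : ℝ) : ℂ) * nevKernel z t) s :=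
        (integrable_mul_nevKernel hu him).integrableOn
      have hpt : ∀ t : ℝ, dslope H (t : ℂ) z = ((u t / (1 + t ^ 2) : ℝ) : ℂ) * nevKernel z t
          + ((u t / (1 + t ^ 2) * t : ℝ) : ℂ) - H z * ((t : ℂ) - z)⁻¹ := by
        intro t
        have h1 : z ≠ t := fun h => hne t (by rw [← h, sub_self])
        have h2 : (1 + (t : ℂ) ^ 2) ≠ 0 := by
          have : (0 : ℝ) < 1 + t ^ 2 := by positivity
          exact_mod_cast this.ne'
        have h3 := hne t
        have h4 : z - (t : ℂ) ≠ 0 := sub_ne_zero.2 h1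
        rw [dslope_of_ne _ h1, slope_def_field, hHu, nevKernel,
          ← neg_sub (t : ℂ) z]
        push_cast
        field_simp
        ring
      have hD : D z = (∫ t in s, ((u t / (1 + t ^ 2) : ℝ) : ℂ) * nevKernel z t) + c
          - H z * (Complex.log ((x + r : ℝ) - z) - Complex.log ((x - r : ℝ) - z)) := by
        simp only [D, hpt]
        rw [integral_sub (f := fun t : ℝ => ((u t / (1 + t ^ 2) : ℝ) : ℂ) * nevKernel z t
            + ((u t / (1 + t ^ 2) * t : ℝ) : ℂ)) (hi3.add hi2) hi1,
          integral_add hi3 hi2, integral_const_mul,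
          ← integral_inv_ofReal_sub him,
          intervalIntegral.integral_of_le (by linarith)]
      rw [outerLog, ← integral_add_compl hs (integrable_mul_nevKernel hu him), hD]
      congr 1
      ring
    have hpi : (2 * Real.pi * I : ℂ) ≠ 0 := Complex.two_pi_I_ne_zero
    have hneg : ((x - r : ℝ) : ℂ) - z = -(z - (x - r : ℝ)) := by ring
    have himw : (z - ((x - r : ℝ) : ℂ)).im = z.im := by
      rw [Complex.sub_im, Complex.ofReal_im, sub_zero]
    constructor
    · intro him
      rw [key him.ne', hneg, log_neg_of_im_pos (by rwa [himw])]
      field_simp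
      ring_nf
    · intro him
      rw [key him.ne, hneg, log_neg_of_im_neg (by rwa [himw]), ← hexpH z hzR, ← Complex.exp_add]
      field_simp
      ring_nf

theorem dense_im_ne_zero : Dense {z : ℂ | z.im ≠ 0} :=
  (dense_compl_singleton (0 : ℝ)).preimage isOpenMap_im

theorem eq_of_eq_of_im_ne_zero {f g : ℂ → ℂ} (hf : Continuous f) (hg : Continuous g)
    (h : ∀ z : ℂ, z.im ≠ 0 → f z = g z) (z : ℂ) : f z = g z :=
  congrFun (hf.ext_on dense_im_ne_zero hg h) z

theorem le_of_le_of_im_ne_zero {f g : ℂ → ℝ} (hf : Continuous f) (hg : Continuous g)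
    (h : ∀ z : ℂ, z.im ≠ 0 → f z ≤ g z) (z : ℂ) : f z ≤ g z :=
  closure_minimal h (isClosed_le hf hg) (dense_im_ne_zero z)

theorem exists_entire_extension {F : ℂ → ℂ} (hd : ∀ z : ℂ, z.im ≠ 0 → DifferentiableAt ℂ F z)
    (hl : ∀ x : ℝ, ∃ r > 0, ∃ E : ℂ → ℂ, DifferentiableOn ℂ E (ball (x : ℂ) r) ∧
      ∀ z ∈ ball (x : ℂ) r, z.im ≠ 0 → E z = F z) :
    ∃ U : ℂ → ℂ, Differentiable ℂ U ∧ ∀ z : ℂ, z.im ≠ 0 → U z = F z := by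
  have hall : ∀ p : ℂ, ∃ r > 0, ∃ E : ℂ → ℂ, DifferentiableOn ℂ E (ball p r) ∧
      ∀ z ∈ ball p r, z.im ≠ 0 → E z = F z := by
    intro p
    by_cases hp : p.im = 0
    · have : ((p.re : ℝ) : ℂ) = p := Complex.ext (by simp) (by simp [hp])
      simpa only [this] using hl p.re
    · have ho : IsOpen {z : ℂ | z.im ≠ 0} :=
        isOpen_ne.preimage Complex.continuous_im
      obtain ⟨r, hr, hsub⟩ := Metric.isOpen_iff.1 ho p hp
      exact ⟨r, hr, F, fun z hz => (hd z (hsub hz)).differentiableWithinAt, fun _ _ _ => rfl⟩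
  choose r hr E hE hEF using hall
  have hagree : ∀ p, ∀ q ∈ ball p (r p), E q q = E p q := by
    intro p q hq
    have hne : (𝓝[{z : ℂ | z.im ≠ 0}] q).NeBot :=
      mem_closure_iff_nhdsWithin_neBot.1 (dense_im_ne_zero q)
    have h1 : Tendsto (E q) (𝓝[{z : ℂ | z.im ≠ 0}] q) (𝓝 (E q q)) :=
      ((hE q).differentiableAt (ball_mem_nhds q (hr q))).continuousAt.mono_left
        nhdsWithin_le_nhds
    have h2 : Tendsto (E p) (𝓝[{z : ℂ | z.im ≠ 0}] q) (𝓝 (E p q)) :=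
      ((hE p).differentiableAt (isOpen_ball.mem_nhds hq)).continuousAt.mono_left
        nhdsWithin_le_nhds
    refine tendsto_nhds_unique (h1.congr' ?_) h2
    filter_upwards [self_mem_nhdsWithin, mem_nhdsWithin_of_mem_nhds (ball_mem_nhds q (hr q)),
      mem_nhdsWithin_of_mem_nhds (isOpen_ball.mem_nhds hq)] with z hz hzq hzp
    rw [hEF q z hzq hz, hEF p z hzp hz]
  refine ⟨fun q => E q q, fun p => ?_, fun z hz => hEF z z (mem_ball_self (hr z)) hz⟩
  refine ((hE p).differentiableAt (ball_mem_nhds p (hr p))).congr_of_eventuallyEq ?_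
  filter_upwards [ball_mem_nhds p (hr p)] with q hq using hagree p q hq

theorem differentiable_estar {F : ℂ → ℂ} (hF : Differentiable ℂ F) :
    Differentiable ℂ (estar F) := fun _ =>
  differentiableAt_conj_conj_iff.2 (hF _)

theorem estar_eq_self {M : ℂ → ℂ} (hM : Differentiable ℂ M) (him : ∀ x : ℝ, (M x).im = 0) :
    estar M = M := by
  refine AnalyticOnNhd.eq_of_frequently_eq (z₀ := 0)
    (fun z _ => (differentiable_estar hM).analyticAt z) (fun z _ => hM.analyticAt z) ?_
  have h1 : Tendsto (fun x : ℝ => (x : ℂ)) (𝓝[≠] 0) (𝓝[≠] 0) := by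
    refine tendsto_nhdsWithin_iff.2 ⟨?_, ?_⟩
    · exact (Complex.continuous_ofReal.tendsto' 0 0 (by simp)).mono_left nhdsWithin_le_nhds
    · filter_upwards [self_mem_nhdsWithin] with x hx
      simpa using hx
  refine h1.frequently (Eventually.frequently (Eventually.of_forall fun x => ?_))
  rw [estar, Complex.conj_ofReal]
  exact Complex.conj_eq_iff_im.2 (him x)

theorem exists_outer {M : ℂ → ℂ} (hM : Differentiable ℂ M)
    (hpos : ∀ x : ℝ, 0 < (M x).re ∧ (M x).im = 0)
    (hu : Integrable fun t : ℝ => Real.log (M t).re / (1 + t ^ 2))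
    (heven : ∀ z : ℂ, M (-z) = M z) :
    ∃ U : ℂ → ℂ, Differentiable ℂ U ∧
      (∀ z : ℂ, 0 < z.im → U z = exp (outerLog (fun t => Real.log (M t).re) z)) ∧
      (∀ z : ℂ, U z * estar U z = M z) ∧ (∀ z : ℂ, estar U z = U (-z)) := by
  set L := outerLog (fun t => Real.log (M t).re) with hL
  have hstar : estar M = M := estar_eq_self hM fun x => (hpos x).2
  have hLneg : ∀ z, L (-z) = -L z := by
    refine outerLog_neg fun t => ?_
    rw [Complex.ofReal_neg, heven]
  have hLconj : ∀ z, exp (L ((starRingEnd ℂ) z)) = (starRingEnd ℂ) (exp (-L z)) := by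
    intro z
    rw [← conj_outerLog_conj, ← Complex.exp_conj, Complex.conj_conj]
  set F : ℂ → ℂ := fun z => if 0 < z.im then exp (L z) else M z * exp (L z) with hF
  have hFd : ∀ z : ℂ, z.im ≠ 0 → DifferentiableAt ℂ F z := by
    intro z hz
    have hLd : DifferentiableAt ℂ L z := differentiableAt_outerLog hu hz
    rcases lt_or_gt_of_ne hz with h | h
    · refine ((hM z).mul hLd.cexp).congr_of_eventuallyEq ?_
      filter_upwards [Complex.continuous_im.continuousAt.eventually_lt_const h] with w hw
      exact if_neg hw.not_gt
    · refine hLd.cexp.congr_of_eventuallyEq ?_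
      filter_upwards [Complex.continuous_im.continuousAt.eventually_const_lt h] with w hw
      exact if_pos hw
  have hFl : ∀ x : ℝ, ∃ r > 0, ∃ E : ℂ → ℂ, DifferentiableOn ℂ E (ball (x : ℂ) r) ∧
      ∀ z ∈ ball (x : ℂ) r, z.im ≠ 0 → E z = F z := by
    intro x
    obtain ⟨r, hr, E, hE, hEz⟩ := exists_local_extension hM hpos hu x
    refine ⟨r, hr, E, hE, fun z hz him => ?_⟩
    rcases lt_or_gt_of_ne him with h | h
    · rw [(hEz z hz).2 h]; exact (if_neg h.not_gt).symm
    · rw [(hEz z hz).1 h]; exact (if_pos h).symm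
  obtain ⟨U, hU, hUF⟩ := exists_entire_extension hFd hFl
  have hup : ∀ z : ℂ, 0 < z.im → U z = exp (L z) := fun z hz => by
    rw [hUF z hz.ne', hF]; exact if_pos hz
  have hdown : ∀ z : ℂ, z.im < 0 → U z = M z * exp (L z) := fun z hz => by
    rw [hUF z hz.ne, hF]; exact if_neg hz.not_gt
  have hsup : ∀ z : ℂ, 0 < z.im → estar U z = M z * exp (-L z) := fun z hz => by
    rw [estar, hdown _ (by simpa using hz), hLconj, map_mul, Complex.conj_conj]
    exact congrArg (· * _) (congrFun hstar z)
  have hsdown : ∀ z : ℂ, z.im < 0 → estar U z = exp (-L z) := fun z hz => by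
    rw [estar, hup _ (by simpa using hz), hLconj, Complex.conj_conj]
  have hUs := differentiable_estar hU
  refine ⟨U, hU, hup, ?_, ?_⟩
  · refine eq_of_eq_of_im_ne_zero (hU.continuous.mul hUs.continuous) hM.continuous fun z hz => ?_
    have he : exp (L z) * exp (-L z) = 1 := by rw [← Complex.exp_add]; simp
    rcases lt_or_gt_of_ne hz with h | h
    · rw [hdown z h, hsdown z h, mul_assoc, he, mul_one]
    · rw [hup z h, hsup z h, mul_left_comm, he, mul_one]
  · refine eq_of_eq_of_im_ne_zero hUs.continuous (hU.continuous.comp continuous_neg)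
      fun z hz => ?_
    rcases lt_or_gt_of_ne hz with h | h
    · rw [hsdown z h, hup (-z) (by simpa using h), hLneg]
    · rw [hsup z h, hdown (-z) (by simpa using h), hLneg, heven]

theorem integral_poisson (x : ℝ) {y : ℝ} (hy : 0 < y) :
    Integrable (fun t : ℝ => y / ((t - x) ^ 2 + y ^ 2)) ∧
    ∫ t : ℝ, y / ((t - x) ^ 2 + y ^ 2) = Real.pi := by
  have h0 : (fun t : ℝ => y / ((t - x) ^ 2 + y ^ 2)) =
      fun t => (fun s : ℝ => y⁻¹ * (fun q : ℝ => (1 + q ^ 2)⁻¹) (s / y)) (t - x) := by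
    ext t
    have h1 : (t - x) ^ 2 + y ^ 2 ≠ 0 := by positivity
    have h2 : 1 + ((t - x) / y) ^ 2 ≠ 0 := by positivity
    field_simp
    ring
  rw [h0]
  constructor
  · exact ((integrable_inv_one_add_sq.comp_div hy.ne').const_mul _).comp_sub_right x
  · rw [integral_sub_right_eq_self (fun s : ℝ => y⁻¹ * (fun q : ℝ => (1 + q ^ 2)⁻¹) (s / y)),
      integral_const_mul, Measure.integral_comp_div (fun q : ℝ => (1 + q ^ 2)⁻¹),
      integral_univ_inv_one_add_sq, abs_of_pos hy, smul_eq_mul]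
    field_simp

theorem norm_le_exp_im_of_upper_half_plane {f : ℂ → ℂ} {τ : ℝ}
    (hd : ∀ z : ℂ, 0 ≤ z.im → DifferentiableAt ℂ f z)
    (hexp : ∃ B C : ℝ, ∀ z : ℂ, 0 < z.im → ‖f z‖ ≤ C * Real.exp (B * ‖z‖))
    (hray : ∀ ε > (0 : ℝ), ∃ C : ℝ, ∀ y : ℝ, 0 < y → ‖f (I * y)‖ ≤ C * Real.exp ((τ + ε) * y))
    (hreal : ∀ x : ℝ, ‖f x‖ ≤ 1) {z : ℂ} (hz : 0 ≤ z.im) :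
    ‖f z‖ ≤ Real.exp (τ * z.im) := by
  have key : ∀ ε > (0 : ℝ), ‖f z‖ ≤ Real.exp ((τ + ε) * z.im) := by
    intro ε hε
    obtain ⟨B, C, hBC⟩ := hexp
    obtain ⟨D, hD⟩ := hray ε hε
    have hnorm : ∀ w : ℂ, ‖f (I * w) * exp (-((τ + ε : ℝ) * w))‖ =
        ‖f (I * w)‖ * Real.exp (-((τ + ε) * w.re)) := by
      intro w
      rw [norm_mul, Complex.norm_exp, Complex.neg_re, Complex.re_ofReal_mul]
    have h := PhragmenLindelof.right_half_plane_of_bounded_on_real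
      (f := fun w => f (I * w) * exp (-((τ + ε : ℝ) * w))) (C := 1) (z := -I * z) ?_
      ⟨1, by norm_num, B + |τ + ε|, ?_⟩ ?_ ?_ ?_
    · rw [hnorm, Real.exp_neg, ← div_eq_mul_inv, div_le_one (Real.exp_pos _)] at h
      rw [neg_mul, mul_neg, ← mul_assoc, Complex.I_mul_I] at h
      simpa using h
    · refine DifferentiableOn.diffContOnCl fun w hw => ?_
      have hw' : 0 ≤ w.re := by
        rw [Complex.closure_setOfPred_lt_re] at hw
        exact hw
      have h1 : DifferentiableAt ℂ f (I * w) := hd _ (by simpa using hw')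
      have h2 : DifferentiableAt ℂ (fun w => f (I * w)) w :=
        h1.comp w (by fun_prop)
      exact (h2.mul (by fun_prop)).differentiableWithinAt
    · refine Asymptotics.IsBigO.of_bound C ?_
      filter_upwards [mem_inf_of_right (mem_principal_self _)] with w hw
      have hw' : 0 < w.re := hw
      rw [hnorm, Real.rpow_one, Real.norm_of_nonneg (Real.exp_pos _).le, add_mul B, Real.exp_add,
        ← mul_assoc]
      have h1 : ‖f (I * w)‖ ≤ C * Real.exp (B * ‖w‖) := by
        simpa using hBC (I * w) (by simpa using hw')
      refine mul_le_mul h1 (Real.exp_le_exp.2 ?_) (Real.exp_pos _).le ((norm_nonneg _).trans h1)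
      have h2 : |w.re| ≤ ‖w‖ := Complex.abs_re_le_norm w
      calc -((τ + ε) * w.re) ≤ |(τ + ε) * w.re| := neg_le_abs _
        _ = |τ + ε| * |w.re| := abs_mul _ _
        _ ≤ _ := by gcongr
    · refine ⟨D, eventually_map.2 ?_⟩
      filter_upwards [eventually_gt_atTop 0] with y hy
      rw [hnorm, Real.exp_neg, ← div_eq_mul_inv, div_le_iff₀ (Real.exp_pos _)]
      exact hD y hy
    · intro x
      rw [hnorm]
      have h1 : I * ((x : ℂ) * I) = ((-x : ℝ) : ℂ) := by
        rw [mul_left_comm, Complex.I_mul_I]; push_cast; ring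
      rw [h1]
      simpa using hreal (-x)
    · simpa using hz
  have hlim : Tendsto (fun ε : ℝ => Real.exp ((τ + ε) * z.im)) (𝓝[>] 0)
      (𝓝 (Real.exp (τ * z.im))) :=
    (Continuous.tendsto' (by fun_prop) _ _ (by simp)).mono_left nhdsWithin_le_nhds
  exact ge_of_tendsto hlim (by filter_upwards [self_mem_nhdsWithin] with ε hε using key ε hε)

theorem norm_le_of_sector {F : ℂ → ℂ} (hF : Differentiable ℂ F)
    (hexp : ∃ B C : ℝ, ∀ z : ℂ, ‖F z‖ ≤ C * Real.exp (B * ‖z‖)) {a C : ℝ} (ha : 0 ≤ a)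
    (h1 : ∀ r : ℝ, 0 ≤ r → ‖F (r * (1 + I))‖ ≤ C * Real.exp (a * r))
    (h2 : ∀ r : ℝ, 0 ≤ r → ‖F (r * (1 - I))‖ ≤ C * Real.exp (a * r))
    {z : ℂ} (hz : |z.im| ≤ z.re) : ‖F z‖ ≤ C * Real.exp (a * ‖z‖) := by
  obtain ⟨B, D, hBD⟩ := hexp
  have hnorm : ∀ w : ℂ, ‖F w * exp (-(a * w))‖ = ‖F w‖ * Real.exp (-(a * w.re)) := by
    intro w
    rw [norm_mul, Complex.norm_exp, Complex.neg_re, Complex.re_ofReal_mul]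
  have hle : ∀ w : ℂ, ‖F w‖ ≤ C * Real.exp (a * w.re) → ‖F w * exp (-(a * w))‖ ≤ C := by
    intro w hw
    rwa [hnorm, Real.exp_neg, ← div_eq_mul_inv, div_le_iff₀ (Real.exp_pos _)]
  have h := PhragmenLindelof.quadrant_I
    (f := fun w => F ((1 - I) * w) * exp (-(a * ((1 - I) * w)))) (C := C)
    (z := z * (1 + I) / 2) ?_ ⟨1, by norm_num, (B + a) * ‖1 - I‖, ?_⟩ ?_ ?_ ?_ ?_
  · have hzz : (1 - I) * (z * (1 + I) / 2) = z := by
      linear_combination (-z / 2) * Complex.I_mul_I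
    rw [hzz, hnorm, Real.exp_neg, ← div_eq_mul_inv, div_le_iff₀ (Real.exp_pos _)] at h
    have hC : 0 ≤ C := by
      have := (norm_nonneg _).trans (h1 0 le_rfl)
      simpa using this
    refine h.trans ?_
    gcongr
    exact Complex.re_le_norm z
  · exact Differentiable.diffContOnCl (by fun_prop)
  · refine Asymptotics.IsBigO.of_bound D (Eventually.of_forall fun w => ?_)
    rw [hnorm, Real.rpow_one, Real.norm_of_nonneg (Real.exp_pos _).le, mul_assoc, ← norm_mul,
      add_mul, Real.exp_add, ← mul_assoc]
    refine mul_le_mul (hBD _) (Real.exp_le_exp.2 ?_) (Real.exp_pos _).le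
      ((norm_nonneg _).trans (hBD _))
    rw [← mul_neg]
    gcongr
    exact (neg_le_abs _).trans (Complex.abs_re_le_norm _)
  · intro r hr
    refine hle _ ?_
    have : ((1 - I) * (r : ℂ)).re = r := by simp
    rw [this, mul_comm]
    exact h2 r hr
  · intro r hr
    refine hle _ ?_
    have : (1 - I) * ((r : ℂ) * I) = r * (1 + I) := by
      linear_combination (-(r : ℂ)) * Complex.I_mul_I
    rw [this]
    have h3 : ((r : ℂ) * (1 + I)).re = r := by simp
    rw [h3]
    exact h1 r hr
  · rw [abs_le] at hz
    simp; linarith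
  · rw [abs_le] at hz
    simp; linarith

theorem norm_le_of_diagonals {F : ℂ → ℂ} (hF : Differentiable ℂ F)
    (hexp : ∃ B C : ℝ, ∀ z : ℂ, ‖F z‖ ≤ C * Real.exp (B * ‖z‖)) {a C : ℝ} (ha : 0 ≤ a)
    (h : ∀ k : ℂ, (k = 1 ∨ k = I ∨ k = -1 ∨ k = -I) → ∀ r : ℝ, 0 ≤ r →
      ‖F (k * (r * (1 + I)))‖ ≤ C * Real.exp (a * r)) (z : ℂ) :
    ‖F z‖ ≤ C * Real.exp (a * ‖z‖) := by
  obtain ⟨B, D, hBD⟩ := hexp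
  have main : ∀ k : ℂ, (k = 1 ∨ k = I ∨ k = -1 ∨ k = -I) → ∀ w : ℂ, |w.im| ≤ w.re →
      ‖F (k * w)‖ ≤ C * Real.exp (a * ‖k * w‖) := by
    intro k hk w hw
    have hk1 : ‖k‖ = 1 := by rcases hk with rfl | rfl | rfl | rfl <;> simp
    have hk' : -I * k = 1 ∨ -I * k = I ∨ -I * k = -1 ∨ -I * k = -I := by
      rcases hk with rfl | rfl | rfl | rfl <;> simp
    rw [norm_mul k w, hk1, one_mul]
    refine norm_le_of_sector (F := fun w => F (k * w)) (by fun_prop)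
      ⟨B, D, fun z => by simpa [hk1] using hBD (k * z)⟩ ha (h k hk) (fun r hr => ?_) hw
    have : k * ((r : ℂ) * (1 - I)) = -I * k * (r * (1 + I)) := by
      linear_combination (k * r) * Complex.I_mul_I
    simp only [this]
    exact h _ hk' r hr
  by_cases h1 : |z.im| ≤ |z.re|
  · rcases le_total 0 z.re with h2 | h2
    · simpa using main 1 (by simp) z (by rwa [abs_of_nonneg h2] at h1)
    · simpa using main (-1) (by simp) (-z) (by rw [abs_of_nonpos h2] at h1; simpa using h1)
  · rw [not_le] at h1
    rcases le_total 0 z.im with h2 | h2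
    · have := main I (by simp) (-I * z) (by rw [abs_of_nonneg h2] at h1; simpa using h1.le)
      simpa [← mul_assoc] using this
    · have := main (-I) (by simp) (I * z) (by rw [abs_of_nonpos h2] at h1; simpa using h1.le)
      simpa [← mul_assoc] using this

theorem nonneg_of_expType {M : ℂ → ℂ} (hM : Differentiable ℂ M) {τ : ℝ} (hτ : ExpType M τ)
    (h0 : M 0 ≠ 0) : 0 ≤ τ := by
  by_contra! hneg
  obtain ⟨C, hC⟩ := hτ (-τ / 2) (by linarith)
  refine h0 (hM.apply_eq_of_tendsto_cocompact 0 (squeeze_zero_norm hC ?_))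
  have h1 : Tendsto (fun z : ℂ => (τ + -τ / 2) * ‖z‖) (cocompact ℂ) atBot :=
    (tendsto_norm_cocompact_atTop).const_mul_atTop_of_neg (by linarith)
  simpa using (Real.tendsto_exp_atBot.comp h1).const_mul C

theorem integrable_log_add {M : ℂ → ℂ} (hM : Continuous M)
    (hpos : ∀ x : ℝ, 0 < (M x).re ∧ (M x).im = 0)
    (hlog : Integrable (fun x : ℝ => Real.log (max ‖M x‖ 1) / (1 + x ^ 2))) {s : ℝ} (hs : 0 < s) :
    Integrable fun t : ℝ => Real.log ((M t).re + s) / (1 + t ^ 2) := by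
  have hc : Continuous fun t : ℝ => (M t).re :=
    Complex.continuous_re.comp (hM.comp Complex.continuous_ofReal)
  refine (hlog.add (integrable_inv_one_add_sq.const_mul (Real.log (1 + s) + |Real.log s|))).mono'
    ?_ (Eventually.of_forall fun t => ?_)
  · refine Continuous.aestronglyMeasurable (Continuous.div ?_ (by fun_prop) fun t => by positivity)
    exact (hc.add continuous_const).log fun t => (add_pos (hpos t).1 hs).ne'
  · have h1 : (0 : ℝ) < 1 + t ^ 2 := by positivity
    rw [Pi.add_apply, norm_div, Real.norm_of_nonneg h1.le, ← div_eq_mul_inv, ← add_div]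
    refine div_le_div_of_nonneg_right ?_ h1.le
    rw [Real.norm_eq_abs]
    have hm1 : (1 : ℝ) ≤ max ‖M t‖ 1 := le_max_right _ _
    have hml : 0 ≤ Real.log (max ‖M t‖ 1) := Real.log_nonneg hm1
    have hs1 : 0 ≤ Real.log (1 + s) := Real.log_nonneg (by linarith)
    have hre : (M t).re ≤ max ‖M t‖ 1 := (Complex.re_le_norm _).trans (le_max_left _ _)
    refine abs_le.2 ⟨?_, ?_⟩
    · have := Real.log_le_log hs (show s ≤ (M t).re + s by linarith [(hpos t).1])
      have := neg_abs_le (Real.log s)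
      linarith
    · have h2 : (M t).re + s ≤ max ‖M t‖ 1 * (1 + s) := by nlinarith
      have h3 := Real.log_le_log (add_pos (hpos t).1 hs) h2
      rw [Real.log_mul (by positivity) (by positivity)] at h3
      have := abs_nonneg (Real.log s)
      linarith

theorem norm_sq_of_mul_estar {U M : ℂ → ℂ} (h : ∀ z, U z * estar U z = M z) (x : ℝ) :
    ‖U x‖ ^ 2 = ‖M x‖ := by
  rw [← h, norm_mul, estar, Complex.conj_ofReal, RCLike.norm_conj, sq]

theorem norm_exp_outerLog {u : ℝ → ℝ} (hu : Integrable fun t => u t / (1 + t ^ 2))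
    {z : ℂ} (hz : z.im ≠ 0) : ‖exp (outerLog u z)‖ ^ 2 =
      Real.exp (Real.pi⁻¹ * ∫ t, u t * (z.im / ((t - z.re) ^ 2 + z.im ^ 2))) := by
  rw [Complex.norm_exp, (outerLog_re hu hz).2, ← Real.exp_nat_mul]
  congr 1
  push_cast
  rw [mul_inv, ← mul_assoc, mul_inv_cancel_left₀ two_ne_zero]

theorem norm_le_exp_poisson_log_add {M : ℂ → ℂ} (hM : Differentiable ℂ M) {τ : ℝ}
    (hτ : ExpType M τ) (hpos : ∀ x : ℝ, 0 < (M x).re ∧ (M x).im = 0)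
    (hlog : Integrable (fun x : ℝ => Real.log (max ‖M x‖ 1) / (1 + x ^ 2)))
    (heven : ∀ z : ℂ, M (-z) = M z) {s : ℝ} (hs : 0 < s) {z : ℂ} (hz : 0 < z.im) :
    ‖M z‖ ≤ Real.exp (Real.pi⁻¹ *
      (∫ t : ℝ, Real.log ((M t).re + s) * (z.im / ((t - z.re) ^ 2 + z.im ^ 2))) + τ * z.im) := by
  have hint := integrable_log_add hM.continuous hpos hlog hs
  have hposs : ∀ x : ℝ, 0 < (M x + s).re ∧ (M x + s).im = 0 := fun x => by
    simpa [(hpos x).2] using add_pos (hpos x).1 hs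
  obtain ⟨U, hU, hUe, hUs, -⟩ := exists_outer (M := fun z => M z + s) (by fun_prop) hposs
    (by simpa using hint) (fun z => by rw [heven])
  simp only [Complex.add_re, Complex.ofReal_re] at hUe
  have hUlow : ∀ w : ℂ, 0 < w.im → s ≤ ‖U w‖ ^ 2 := by
    intro w hw
    have hP := integral_poisson w.re hw
    rw [hUe w hw, norm_exp_outerLog hint hw.ne']
    calc s = Real.exp (Real.pi⁻¹ * ∫ t, Real.log s * (w.im / ((t - w.re) ^ 2 + w.im ^ 2))) := by
          rw [integral_const_mul, hP.2, mul_comm, mul_assoc, mul_inv_cancel₀ Real.pi_ne_zero,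
            mul_one, Real.exp_log hs]
      _ ≤ _ := by
          refine Real.exp_le_exp.2 (mul_le_mul_of_nonneg_left ?_ (by positivity))
          refine integral_mono (hP.1.const_mul _) (outerLog_re hint hw.ne').1 fun t => ?_
          refine mul_le_mul_of_nonneg_right (Real.log_le_log hs ?_) (by positivity)
          linarith [(hpos t).1]
  have hU0 : ∀ w : ℂ, 0 ≤ w.im → U w ≠ 0 := by
    intro w hw h0
    rcases hw.eq_or_lt with h | h
    · have hw' : ((w.re : ℝ) : ℂ) = w := Complex.ext (by simp) (by simp [← h])
      have h1 := hUs w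
      rw [h0, zero_mul, ← hw'] at h1
      exact (hposs w.re).1.ne (by rw [← h1]; simp)
    · have := hUlow w h
      rw [h0] at this
      simp at this
      linarith
  have hfle : ∀ w : ℂ, 0 < w.im → ‖M w / U w ^ 2‖ ≤ ‖M w‖ / s := by
    intro w hw
    rw [norm_div, norm_pow]
    gcongr
    exact hUlow w hw
  have key := norm_le_exp_im_of_upper_half_plane (f := fun w => M w / U w ^ 2) (τ := τ)
    (fun w hw => (hM w).div ((hU w).pow 2) (pow_ne_zero 2 (hU0 w hw))) ?_ ?_ ?_ hz.le
  · rw [norm_div, norm_pow, div_le_iff₀ (pow_pos (norm_pos_iff.2 (hU0 z hz.le)) 2), hUe z hz,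
      norm_exp_outerLog hint hz.ne', ← Real.exp_add, add_comm] at key
    exact key
  · obtain ⟨C, hC⟩ := hτ 1 one_pos
    refine ⟨τ + 1, C / s, fun w hw => (hfle w hw).trans ?_⟩
    rw [div_mul_eq_mul_div]
    gcongr
    exact hC w
  · intro ε hε
    obtain ⟨C, hC⟩ := hτ ε hε
    refine ⟨C / s, fun y hy => (hfle _ (by simpa using hy)).trans ?_⟩
    rw [div_mul_eq_mul_div]
    gcongr
    simpa [abs_of_pos hy] using hC (I * y)
  · intro x
    have h1 : ‖M x + s‖ = (M x).re + s := by
      have : M x + s = (((M x).re + s : ℝ) : ℂ) :=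
        Complex.ext (by simp) (by simp [(hpos x).2])
      rw [this, Complex.norm_of_nonneg (add_pos (hpos x).1 hs).le]
    have h2 : ‖M x‖ = (M x).re := by
      have : M x = (((M x).re : ℝ) : ℂ) := Complex.ext (by simp) (by simp [(hpos x).2])
      rw [this, Complex.norm_of_nonneg (hpos x).1.le, Complex.ofReal_re]
    rw [norm_div, norm_pow, norm_sq_of_mul_estar hUs, h1, h2,
      div_le_one (add_pos (hpos x).1 hs)]
    linarith

theorem integrable_log_re {M : ℂ → ℂ} (hM : Differentiable ℂ M) {τ : ℝ}
    (hτ : ExpType M τ) (hpos : ∀ x : ℝ, 0 < (M x).re ∧ (M x).im = 0)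
    (hlog : Integrable (fun x : ℝ => Real.log (max ‖M x‖ 1) / (1 + x ^ 2)))
    (heven : ∀ z : ℂ, M (-z) = M z) :
    Integrable fun t : ℝ => Real.log (M t).re / (1 + t ^ 2) := by
  obtain ⟨y, hy, hMy⟩ : ∃ y : ℝ, 0 < y ∧ M (I * y) ≠ 0 := by
    have h0 : M 0 ≠ 0 := fun h => (hpos 0).1.ne (by simp [h])
    have hc : ContinuousAt (fun y : ℝ => M (I * y)) 0 := by
      have := hM.continuous
      fun_prop
    have h1 : ∀ᶠ y : ℝ in 𝓝 0, M (I * y) ≠ 0 := hc.eventually_ne (by simpa using h0)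
    have h2 : ∀ᶠ y : ℝ in 𝓝[>] 0, 0 < y ∧ M (I * y) ≠ 0 :=
      (eventually_mem_nhdsWithin).and (h1.filter_mono nhdsWithin_le_nhds)
    exact h2.exists
  set s : ℕ → ℝ := fun n => 1 / (n + 1) with hs_def
  have hs : ∀ n, 0 < s n := fun n => by positivity
  have hs1 : ∀ n, s n ≤ 1 := fun n => by
    rw [hs_def, div_le_one (by positivity)]; simp
  set p : ℝ → ℝ := fun t => y / ((t - 0) ^ 2 + y ^ 2) with hp_def
  have hp : ∀ t, 0 ≤ p t := fun t => by positivity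
  set G : ℕ → ℝ → ℝ := fun n t => Real.log ((M t).re + s n) * p t with hG_def
  have him : (I * (y : ℂ)).im = y := by simp
  have hre : (I * (y : ℂ)).re = 0 := by simp
  have hGi : ∀ n, Integrable (G n) := fun n => by
    have := (outerLog_re (integrable_log_add hM.continuous hpos hlog (hs n))
      (z := I * y) (by rw [him]; exact hy.ne')).1
    simpa only [him, hre] using this
  have hGlow : ∀ n, Real.pi * (Real.log ‖M (I * y)‖ - τ * y) ≤ ∫ t, G n t := fun n => by
    have h1 := norm_le_exp_poisson_log_add hM hτ hpos hlog heven (hs n) (z := I * y)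
      (by rw [him]; exact hy)
    rw [← Real.log_le_iff_le_exp (norm_pos_iff.2 hMy)] at h1
    simp only [him, hre] at h1
    have h2 : Real.log ‖M (I * y)‖ - τ * y ≤ Real.pi⁻¹ * ∫ t, G n t := by linarith
    calc _ ≤ Real.pi * (Real.pi⁻¹ * ∫ t, G n t) :=
          mul_le_mul_of_nonneg_left h2 Real.pi_pos.le
      _ = _ := by rw [← mul_assoc, mul_inv_cancel₀ Real.pi_ne_zero, one_mul]
  have hGmono : ∀ n t, G n t ≤ G 0 t := fun n t => by
    refine mul_le_mul_of_nonneg_right (Real.log_le_log (add_pos (hpos t).1 (hs n)) ?_) (hp t)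
    have : s 0 = 1 := by simp [hs_def]
    rw [this]
    linarith [hs1 n]
  have hGabs : ∀ n, ∫ t, ‖G n t‖ ≤
      2 * (∫ t, ‖G 0 t‖) - Real.pi * (Real.log ‖M (I * y)‖ - τ * y) := fun n => by
    calc ∫ t, ‖G n t‖ ≤ ∫ t, (2 * ‖G 0 t‖ - G n t) := by
          refine integral_mono (hGi n).norm (((hGi 0).norm.const_mul 2).sub (hGi n)) fun t => ?_
          have h1 := hGmono n t
          have h2 := le_abs_self (G 0 t)
          have h3 := abs_nonneg (G 0 t)
          simp only [Real.norm_eq_abs]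
          rcases abs_cases (G n t) with h | h <;> linarith
      _ = 2 * (∫ t, ‖G 0 t‖) - ∫ t, G n t := by
          rw [integral_sub ((hGi 0).norm.const_mul 2) (hGi n), integral_const_mul]
      _ ≤ _ := by linarith [hGlow n]
  have hF : Integrable fun t : ℝ => Real.log (M t).re * p t := by
    refine integrable_of_tendsto (G := G) (Eventually.of_forall fun t => ?_)
      (fun n => (hGi n).1) (ne_of_lt (lt_of_le_of_lt (liminf_le_of_frequently_le'
        (Frequently.of_forall fun n => ?_)) (ENNReal.ofReal_lt_top
          (r := 2 * (∫ t, ‖G 0 t‖) - Real.pi * (Real.log ‖M (I * y)‖ - τ * y)))))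
    · refine Tendsto.mul_const _ ?_
      have h1 : Tendsto (fun n => (M t).re + s n) atTop (𝓝 (M t).re) := by
        simpa [hs_def] using tendsto_one_div_add_atTop_nhds_zero_nat.const_add (M t).re
      exact h1.log (hpos t).1.ne'
    · rw [← ofReal_integral_norm_eq_lintegral_enorm (hGi n)]
      exact ENNReal.ofReal_le_ofReal (hGabs n)
  have hbd : Integrable fun t : ℝ =>
      Real.log (M t).re * p t * ((t ^ 2 + y ^ 2) / (y * (1 + t ^ 2))) := by
    refine hF.mul_bdd (c := (1 + y ^ 2) / y)
      (Continuous.aestronglyMeasurable (Continuous.div (by fun_prop) (by fun_prop)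
        fun t => by positivity)) (Eventually.of_forall fun t => ?_)
    rw [Real.norm_of_nonneg (by positivity), div_le_div_iff₀ (by positivity) hy]
    nlinarith [mul_nonneg hy.le (mul_nonneg (sq_nonneg y) (sq_nonneg t))]
  refine hbd.congr (Eventually.of_forall fun t => ?_)
  simp only [hp_def, sub_zero]
  field_simp

theorem norm_le_exp_poisson_log {M : ℂ → ℂ} (hM : Differentiable ℂ M) {τ : ℝ}
    (hτ : ExpType M τ) (hpos : ∀ x : ℝ, 0 < (M x).re ∧ (M x).im = 0)
    (hlog : Integrable (fun x : ℝ => Real.log (max ‖M x‖ 1) / (1 + x ^ 2)))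
    (heven : ∀ z : ℂ, M (-z) = M z) {z : ℂ} (hz : 0 < z.im) :
    ‖M z‖ ≤ Real.exp (Real.pi⁻¹ *
      (∫ t : ℝ, Real.log (M t).re * (z.im / ((t - z.re) ^ 2 + z.im ^ 2))) + τ * z.im) := by
  set p : ℝ → ℝ := fun t => z.im / ((t - z.re) ^ 2 + z.im ^ 2) with hp_def
  have hp : ∀ t, 0 ≤ p t := fun t => by positivity
  have h0 := (outerLog_re (integrable_log_re hM hτ hpos hlog heven) hz.ne').1
  have h1 := (outerLog_re (integrable_log_add hM.continuous hpos hlog one_pos) hz.ne').1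
  have hlim : Tendsto (fun n : ℕ => ∫ t : ℝ, Real.log ((M t).re + 1 / (n + 1)) * p t) atTop
      (𝓝 (∫ t : ℝ, Real.log (M t).re * p t)) := by
    refine tendsto_integral_of_dominated_convergence
      (fun t => ‖Real.log (M t).re * p t‖ + ‖Real.log ((M t).re + 1) * p t‖)
      (fun n => (outerLog_re (integrable_log_add hM.continuous hpos hlog
        (Nat.one_div_pos_of_nat (n := n))) hz.ne').1.1) (h0.norm.add h1.norm)
      (fun n => Eventually.of_forall fun t => ?_) (Eventually.of_forall fun t => ?_)
    · have hn : (0 : ℝ) < 1 / (n + 1) := Nat.one_div_pos_of_nat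
      have hn1 : (1 : ℝ) / (n + 1) ≤ 1 := by
        rw [div_le_one (by positivity)]; simp
      have h2 := mul_le_mul_of_nonneg_right (Real.log_le_log (hpos t).1
        (show (M t).re ≤ (M t).re + 1 / (n + 1) by linarith)) (hp t)
      have h3 := mul_le_mul_of_nonneg_right (Real.log_le_log (add_pos (hpos t).1 hn)
        (show (M t).re + 1 / (n + 1) ≤ (M t).re + 1 by linarith)) (hp t)
      simp only [Real.norm_eq_abs]
      refine abs_le.2 ⟨?_, ?_⟩
      · linarith [neg_abs_le (Real.log (M t).re * p t), abs_nonneg (Real.log ((M t).re + 1) * p t)]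
      · linarith [le_abs_self (Real.log ((M t).re + 1) * p t), abs_nonneg (Real.log (M t).re * p t)]
    · refine Tendsto.mul_const _ ?_
      have h1 : Tendsto (fun n : ℕ => (M t).re + 1 / ((n : ℝ) + 1)) atTop (𝓝 (M t).re) := by
        simpa using tendsto_one_div_add_atTop_nhds_zero_nat.const_add (M t).re
      exact h1.log (hpos t).1.ne'
  refine ge_of_tendsto' (((hlim.const_mul _).add_const _).rexp) fun n => ?_
  exact norm_le_exp_poisson_log_add hM hτ hpos hlog heven Nat.one_div_pos_of_nat hz

theorem integral_mul_poisson_le {u : ℝ → ℝ} (hu0 : ∀ t, 0 ≤ u t)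
    (hu : Integrable fun t => u t / (1 + t ^ 2)) {A B : ℝ} (hA : 0 ≤ A) (hB : 0 ≤ B)
    (hAB : ∀ t, u t ≤ A + B * |t|) {z : ℂ} (hz : 0 < z.im) :
    ∫ t, u t * (z.im / ((t - z.re) ^ 2 + z.im ^ 2)) ≤
      Real.pi * (A + B * (2 * ‖z‖ + 1)) + 8 * ‖z‖ * ∫ t, u t / (1 + t ^ 2) := by
  have hp := integral_poisson z.re hz
  have hz0 := norm_nonneg z
  calc ∫ t, u t * (z.im / ((t - z.re) ^ 2 + z.im ^ 2))
      ≤ ∫ t, ((A + B * (2 * ‖z‖ + 1)) * (z.im / ((t - z.re) ^ 2 + z.im ^ 2)) +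
          8 * ‖z‖ * (u t / (1 + t ^ 2))) := by
        refine integral_mono (outerLog_re hu hz.ne').1
          ((hp.1.const_mul _).add (hu.const_mul _)) fun t => ?_
        have h1 : 0 ≤ z.im / ((t - z.re) ^ 2 + z.im ^ 2) := by positivity
        have h2 : 0 ≤ u t / (1 + t ^ 2) := div_nonneg (hu0 t) (by positivity)
        rcases le_or_gt |t| (2 * ‖z‖ + 1) with h | h
        · have h3 : u t ≤ A + B * (2 * ‖z‖ + 1) := (hAB t).trans (by gcongr)
          exact (mul_le_mul_of_nonneg_right h3 h1).trans
            (le_add_of_nonneg_right (by positivity))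
        · refine le_trans ?_ (le_add_of_nonneg_left (by positivity))
          have h3 : |t| / 2 ≤ |t - z.re| := by
            have := abs_sub_abs_le_abs_sub t z.re
            linarith [Complex.abs_re_le_norm z]
          have h4 : t ^ 2 ≤ 4 * (t - z.re) ^ 2 := by
            rw [← sq_abs t, ← sq_abs (t - z.re)]
            nlinarith [abs_nonneg t]
          have h5 : 1 ≤ t ^ 2 := by
            rw [← sq_abs t]
            nlinarith
          have h6 : z.im / ((t - z.re) ^ 2 + z.im ^ 2) ≤ 8 * ‖z‖ / (1 + t ^ 2) := by
            rw [div_le_div_iff₀ (by positivity) (by positivity)]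
            have h7 : z.im ≤ ‖z‖ := (le_abs_self _).trans (Complex.abs_im_le_norm z)
            have h8 : 1 + t ^ 2 ≤ 8 * ((t - z.re) ^ 2 + z.im ^ 2) := by
              linarith [sq_nonneg z.im]
            nlinarith [mul_le_mul h7 h8 (by positivity) hz0]
          calc _ ≤ u t * (8 * ‖z‖ / (1 + t ^ 2)) := mul_le_mul_of_nonneg_left h6 (hu0 t)
            _ = _ := by ring
    _ = _ := by
        rw [integral_add (hp.1.const_mul _) (hu.const_mul _), integral_const_mul,
          integral_const_mul, hp.2, mul_comm Real.pi]

theorem exists_integral_mul_poisson_diagonal_le {u : ℝ → ℝ} (hu0 : ∀ t, 0 ≤ u t)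
    (hu : Integrable fun t => u t / (1 + t ^ 2)) {A B : ℝ} (hA : 0 ≤ A) (hB : 0 ≤ B)
    (hAB : ∀ t, u t ≤ A + B * |t|) {ε : ℝ} (hε : 0 < ε) :
    ∃ C : ℝ, ∀ r : ℝ, 0 < r → ∫ t, u t * (r / ((t - r) ^ 2 + r ^ 2)) ≤ C + ε * r := by
  have hpt : ∀ r t : ℝ, 0 < r → u t * (r / ((t - r) ^ 2 + r ^ 2)) =
      r * (u t / ((t - r) ^ 2 + r ^ 2)) := fun r t _ => by ring
  have hint : ∀ r : ℝ, 0 < r → Integrable fun t => u t * (r / ((t - r) ^ 2 + r ^ 2)) :=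
    fun r hr => (outerLog_re hu (z := ⟨r, r⟩) hr.ne').1
  have hlim : Tendsto (fun r : ℝ => ∫ t, u t / ((t - r) ^ 2 + r ^ 2)) atTop (𝓝 0) := by
    rw [← integral_zero ℝ ℝ (μ := volume)]
    refine tendsto_integral_filter_of_dominated_convergence (fun t => 4 * (u t / (1 + t ^ 2)))
      ?_ ?_ (hu.const_mul 4) (Eventually.of_forall fun t => ?_)
    · filter_upwards [eventually_gt_atTop 0] with r hr
      refine ((hint r hr).1.const_mul r⁻¹).congr (Eventually.of_forall fun t => ?_)
      simp only [hpt r t hr]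
      rw [inv_mul_cancel_left₀ hr.ne']
    · filter_upwards [eventually_ge_atTop 1] with r hr
      refine Eventually.of_forall fun t => ?_
      have h1 : 0 < (t - r) ^ 2 + r ^ 2 := by positivity
      rw [Real.norm_of_nonneg (div_nonneg (hu0 t) h1.le), ← mul_div_assoc,
        div_le_div_iff₀ h1 (by positivity), mul_comm 4 (u t), mul_assoc]
      refine mul_le_mul_of_nonneg_left ?_ (hu0 t)
      nlinarith [sq_nonneg (3 * t - 4 * r)]
    · refine Tendsto.const_div_atTop (tendsto_atTop_mono (fun r => ?_)
        (tendsto_pow_atTop two_ne_zero)) _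
      linarith [sq_nonneg (t - r)]
  obtain ⟨R, hR⟩ := eventually_atTop.1 (hlim.eventually (gt_mem_nhds hε))
  have hJ : 0 ≤ ∫ t, u t / (1 + t ^ 2) :=
    integral_nonneg fun t => div_nonneg (hu0 t) (by positivity)
  set J := ∫ t, u t / (1 + t ^ 2)
  refine ⟨Real.pi * (A + B * (2 * (2 * |R|) + 1)) + 8 * (2 * |R|) * J, fun r hr => ?_⟩
  rcases le_or_gt R r with h | h
  · refine le_trans ?_ (le_add_of_nonneg_left (by positivity))
    simp only [hpt r _ hr]
    rw [integral_const_mul, mul_comm ε]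
    exact mul_le_mul_of_nonneg_left (hR r h).le hr.le
  · refine le_trans ?_ (le_add_of_nonneg_right (by positivity))
    have hz : ‖(⟨r, r⟩ : ℂ)‖ ≤ 2 * |R| := by
      refine (Complex.norm_le_abs_re_add_abs_im _).trans ?_
      simp only [abs_of_pos hr]
      linarith [le_abs_self R]
    refine (integral_mul_poisson_le hu0 hu hA hB hAB (z := ⟨r, r⟩) hr).trans ?_
    gcongr

theorem exists_log_max_le {M : ℂ → ℂ} {τ : ℝ} (hτ : ExpType M τ) (h0 : 0 ≤ τ) :
    ∃ A B : ℝ, 0 ≤ A ∧ 0 ≤ B ∧ ∀ t : ℝ, Real.log (max ‖M t‖ 1) ≤ A + B * |t| := by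
  obtain ⟨C, hC⟩ := hτ 1 one_pos
  refine ⟨Real.log (max C 1), τ + 1, Real.log_nonneg (le_max_right _ _), by linarith, fun t => ?_⟩
  have h1 : 0 < max C 1 := lt_max_of_lt_right one_pos
  have h2 : 0 < max ‖M t‖ 1 := lt_max_of_lt_right one_pos
  rw [Real.log_le_iff_le_exp h2, Real.exp_add, Real.exp_log h1]
  have h3 : 1 ≤ Real.exp ((τ + 1) * |t|) := Real.one_le_exp (by positivity)
  refine max_le ((hC t).trans ?_) ?_
  · rw [Complex.norm_real, Real.norm_eq_abs]
    gcongr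
    exact le_max_left _ _
  · nlinarith [le_max_right C 1]

theorem expType_of_poisson_bound {V : ℂ → ℂ} (hV : Differentiable ℂ V) {τ : ℝ} (h0 : 0 ≤ τ)
    {u : ℝ → ℝ} (hu0 : ∀ t, 0 ≤ u t)
    (hu : Integrable fun t => u t / (1 + t ^ 2)) {A B : ℝ} (hA : 0 ≤ A) (hB : 0 ≤ B)
    (hAB : ∀ t, u t ≤ A + B * |t|)
    (hup : ∀ z : ℂ, 0 < z.im → ‖V z‖ ≤ Real.exp ((2 * Real.pi)⁻¹ *
      (∫ t, u t * (z.im / ((t - z.re) ^ 2 + z.im ^ 2))) + τ * z.im))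
    (hle : ∀ z : ℂ, 0 < z.im → ‖estar V z‖ ≤ ‖V z‖)
    (hsymm : ∀ z : ℂ, estar V z = V (-z)) : ExpType V τ := by
  set J := ∫ t, u t / (1 + t ^ 2)
  have hconj : ∀ z : ℂ, ‖V ((starRingEnd ℂ) z)‖ = ‖estar V z‖ := fun z => by
    rw [estar, RCLike.norm_conj]
  have hlow : ∀ z : ℂ, 0 < z.im → ‖V ((starRingEnd ℂ) z)‖ ≤ ‖V z‖ := fun z hz =>
    (hconj z).trans_le (hle z hz)
  have hneg : ∀ z : ℂ, ‖V (-z)‖ = ‖V ((starRingEnd ℂ) z)‖ := fun z => by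
    rw [hconj, hsymm]
  have hexp : ∃ B C : ℝ, ∀ z : ℂ, ‖V z‖ ≤ C * Real.exp (B * ‖z‖) := by
    set a := (2 * Real.pi)⁻¹ * (Real.pi * (A + B))
    set b := (2 * Real.pi)⁻¹ * (Real.pi * (2 * B) + 8 * J) + τ
    have hz : ∀ z : ℂ, 0 < z.im → ‖V z‖ ≤ Real.exp a * Real.exp (b * ‖z‖) := fun z hz => by
      refine (hup z hz).trans ?_
      rw [← Real.exp_add]
      refine Real.exp_le_exp.2 ?_
      have h1 := mul_le_mul_of_nonneg_left (integral_mul_poisson_le hu0 hu hA hB hAB hz)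
        (show 0 ≤ (2 * Real.pi)⁻¹ by positivity)
      have h2 := mul_le_mul_of_nonneg_left
        ((le_abs_self _).trans (Complex.abs_im_le_norm z)) h0
      refine (add_le_add h1 h2).trans (le_of_eq ?_)
      ring
    refine ⟨b, Real.exp a, le_of_le_of_im_ne_zero hV.continuous.norm (by fun_prop)
      fun z hne => ?_⟩
    rcases lt_or_gt_of_ne hne with h | h
    · have h1 : 0 < ((starRingEnd ℂ) z).im := by simpa using h
      have h2 := (hlow _ h1).trans (hz _ h1)
      rwa [Complex.conj_conj, RCLike.norm_conj] at h2
    · exact hz z h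
  intro ε hε
  obtain ⟨C, hC⟩ := exists_integral_mul_poisson_diagonal_le hu0 hu hA hB hAB hε
  set D := max (Real.exp ((2 * Real.pi)⁻¹ * C)) ‖V 0‖
  refine ⟨D, fun z => norm_le_of_diagonals hV hexp (add_nonneg h0 hε.le) (fun k hk r hr => ?_) z⟩
  rcases hr.eq_or_lt with rfl | hr
  · simp [D]
  have hone : ‖V (r * (1 + I))‖ ≤ D * Real.exp ((τ + ε) * r) := by
    have him : ((r : ℂ) * (1 + I)).im = r := by simp
    have hre : ((r : ℂ) * (1 + I)).re = r := by simp
    have h1 := hup (r * (1 + I)) (by rwa [him])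
    rw [him, hre] at h1
    refine h1.trans (le_trans ?_ (mul_le_mul_of_nonneg_right (le_max_left _ _)
      (Real.exp_pos _).le))
    rw [← Real.exp_add]
    refine Real.exp_le_exp.2 ?_
    have h2 := mul_le_mul_of_nonneg_left (hC r hr) (show 0 ≤ (2 * Real.pi)⁻¹ by positivity)
    have h3 : (2 * Real.pi)⁻¹ * (ε * r) ≤ ε * r :=
      mul_le_of_le_one_left (by positivity)
        (inv_le_one_of_one_le₀ (by linarith [Real.pi_gt_three]))
    linarith
  have him : 0 < ((r : ℂ) * (1 + I)).im := by simpa using hr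
  have hcj : (starRingEnd ℂ) ((r : ℂ) * (1 + I)) = r * (1 - I) := by
    simp [sub_eq_add_neg]
  have hfour : ‖V (-(r * (1 - I)))‖ = ‖V (r * (1 + I))‖ := by
    rw [hneg, ← hcj, Complex.conj_conj]
  rcases hk with rfl | rfl | rfl | rfl
  · rwa [one_mul]
  · rw [show I * ((r : ℂ) * (1 + I)) = -(r * (1 - I)) by linear_combination (r : ℂ) * I_mul_I,
      hfour]
    exact hone
  · rw [neg_one_mul, hneg]
    exact (hlow _ him).trans hone
  · rw [show -I * ((r : ℂ) * (1 + I)) = r * (1 - I) by linear_combination -(r : ℂ) * I_mul_I,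
      ← hcj]
    exact (hlow _ him).trans hone

/-- Akhiezer factorization for an even positive function: if `M` is
entire of exponential type `τ`, positive on `ℝ`, with convergent logarithmic
integral, and even, then `M = U U*` with `U` of exponential type `τ/2`, all zeros
of `U` in the open lower half-plane, and `U*(z) = U(-z)`. -/
theorem akhiezer_factorization_even
    (M : ℂ → ℂ) (hM : Differentiable ℂ M)
    (τ : ℝ) (hτ : ExpType M τ) (hτmin : ∀ σ : ℝ, ExpType M σ → τ ≤ σ)
    (hpos : ∀ x : ℝ, 0 < (M x).re ∧ (M x).im = 0)
    (hlog : Integrable (fun x : ℝ => Real.log (max ‖M x‖ 1) / (1 + x ^ 2)))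
    (heven : ∀ z : ℂ, M (-z) = M z) :
    ∃ U : ℂ → ℂ, Differentiable ℂ U ∧
      ExpType U (τ / 2) ∧
      (∀ z : ℂ, U z = 0 → z.im < 0) ∧
      (∀ z : ℂ, U z * estar U z = M z) ∧
      (∀ z : ℂ, estar U z = U (-z)) := by
  have h0 : 0 ≤ τ := nonneg_of_expType hM hτ fun h => (hpos 0).1.ne (by simp [h])
  have hu := integrable_log_re hM hτ hpos hlog heven
  obtain ⟨U, hU, hUe, hUs, hUn⟩ := exists_outer hM hpos hu heven
  obtain ⟨A, B, hA, hB, hAB⟩ := exists_log_max_le hτ h0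
  have hsq : ∀ z : ℂ, 0 < z.im → ‖U z‖ ^ 2 = Real.exp (Real.pi⁻¹ *
      ∫ t : ℝ, Real.log (M t).re * (z.im / ((t - z.re) ^ 2 + z.im ^ 2))) := fun z hz => by
    rw [hUe z hz, norm_exp_outerLog hu hz.ne']
  set e : ℂ → ℂ := fun z => exp (-(I * τ * z / 2)) with he
  have hnorm : ∀ z : ℂ, ‖e z‖ = Real.exp (τ / 2 * z.im) := fun z => by
    rw [he, Complex.norm_exp]
    congr 1
    simp
    ring
  have hestar : ∀ z : ℂ, estar e z = e (-z) := fun z => by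
    simp only [he, estar, ← Complex.exp_conj]
    congr 1
    simp [map_ofNat]
  have hee : ∀ z : ℂ, e z * e (-z) = 1 := fun z => by
    rw [he, ← Complex.exp_add, ← Complex.exp_zero]
    congr 1
    ring
  have hmul : ∀ z : ℂ, estar (fun z => U z * e z) z = estar U z * e (-z) := fun z => by
    rw [← hestar, estar, map_mul]
    rfl
  have hV : Differentiable ℂ fun z => U z * e z := hU.mul (by fun_prop)
  have hprod : ∀ z : ℂ, U z * e z * estar (fun z => U z * e z) z = M z := fun z => by
    rw [hmul, mul_mul_mul_comm, hUs, hee, mul_one]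
  have hsymm : ∀ z : ℂ, estar (fun z => U z * e z) z = U (-z) * e (-z) := fun z => by
    rw [hmul, hUn]
  have hVpos : ∀ z : ℂ, 0 < z.im → U z * e z ≠ 0 := fun z hz =>
    mul_ne_zero (by rw [hUe z hz]; exact exp_ne_zero _) (exp_ne_zero _)
  refine ⟨fun z => U z * e z, hV, ?_, fun z hz => ?_, hprod, hsymm⟩
  · refine expType_of_poisson_bound hV (by positivity)
      (fun t => Real.log_nonneg (le_max_right _ _)) hlog hA hB hAB (fun z hz => ?_)
      (fun z hz => ?_) hsymm
    · rw [norm_mul, hnorm, Real.exp_add]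
      refine mul_le_mul_of_nonneg_right ?_ (Real.exp_pos _).le
      rw [← pow_le_pow_iff_left₀ (norm_nonneg _) (Real.exp_pos _).le two_ne_zero, hsq z hz,
        ← Real.exp_nat_mul]
      refine Real.exp_le_exp.2 ?_
      push_cast
      rw [mul_inv, ← mul_assoc, mul_inv_cancel_left₀ two_ne_zero]
      refine mul_le_mul_of_nonneg_left (integral_mono (outerLog_re hu hz.ne').1
        (outerLog_re hlog hz.ne').1 fun t => ?_) (by positivity)
      refine mul_le_mul_of_nonneg_right (Real.log_le_log (hpos t).1 ?_) (by positivity)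
      exact (Complex.re_le_norm _).trans (le_max_left _ _)
    · have h1 := norm_le_exp_poisson_log hM hτ hpos hlog heven hz
      rw [Real.exp_add, ← hsq z hz, ← hprod, norm_mul] at h1
      have h2 : ‖U z * e z‖ ^ 2 = ‖U z‖ ^ 2 * Real.exp (τ * z.im) := by
        rw [norm_mul, mul_pow, hnorm, ← Real.exp_nat_mul]
        congr 2
        push_cast
        ring
      rw [← h2, sq] at h1
      exact le_of_mul_le_mul_left h1 (norm_pos_iff.2 (hVpos z hz))
  · by_contra! h
    rcases h.eq_or_lt with h | h
    · have h1 : ((z.re : ℝ) : ℂ) = z := Complex.ext (by simp) (by simp [← h])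
      have h2 := hprod z
      rw [show U z * e z = 0 from hz, zero_mul, ← h1] at h2
      exact (hpos z.re).1.ne (by rw [← h2]; simp)
    · exact hVpos z h hz
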